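/- arXiv:2005.14468 — 5 statements merged into one kernel-verified Lean document; each statement's English description precedes it below -/
import Mathlib

section
/- Let N and n be positive integers with n < N. Let C ∈ ℝ^{N×N} be symmetric positive semidefinite of rank n, let V_C ∈ ℝ^{N×n} have orthonormal columns spanning the range of C and let V_N ∈ ℝ^{N×(N−n)} have orthonormal columns spanning the null space of C. Let G ∈ ℝ^{N×N} satisfy v^T G v ≥ ε‖v‖² for all v ∈ ℝ^N for some ε > 0 (so G is invertible). Set C1 = V_C^T C V_C, G1 = V_C^T G V_C, G2 = V_C^T G V_N, G3 = V_N^T G V_C, G4 = V_N^T G V_N, and B11 = V_C^T G^{-1} C V_C. Then G4 is invertible, B11 is invertible, and B11^{-1} = C1^{-1}(G1 − G2 G4^{-1} G3). -/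
open Matrix

/-- A real square matrix whose quadratic form is coercive is invertible. -/
theorem Matrix.isUnit_of_coercive {m : Type*} [Fintype m] [DecidableEq m] {A : Matrix m m ℝ}
    {ε : ℝ} (hε : 0 < ε) (hA : ∀ v : m → ℝ, ε * (v ⬝ᵥ v) ≤ v ⬝ᵥ A *ᵥ v) : IsUnit A := by
  rw [← mulVec_injective_iff_isUnit]
  change Function.Injective A.mulVecLin
  refine (injective_iff_map_eq_zero A.mulVecLin).2 fun v hv => ?_
  have h := hA v
  rw [mulVecLin_apply] at hv
  rw [hv, dotProduct_zero] at h
  have h_nonneg : 0 ≤ v ⬝ᵥ v := Finset.sum_nonneg fun i _ => mul_self_nonneg (v i)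
  exact dotProduct_self_eq_zero.1 (by nlinarith)

/-- A matrix whose range is contained in the range of `A` factors through `A` on the left. -/
theorem Matrix.exists_eq_mul_of_range_le {l m k : Type*} [Fintype m] [Fintype k] [DecidableEq k]
    {A : Matrix l m ℝ} {B : Matrix l k ℝ}
    (h : LinearMap.range B.mulVecLin ≤ LinearMap.range A.mulVecLin) :
    ∃ X : Matrix m k ℝ, B = A * X := by
  have hcol (j : k) : ∃ x : m → ℝ, A *ᵥ x = B.col j := by
    obtain ⟨x, hx⟩ := h ⟨Pi.single j 1, rfl⟩
    exact ⟨x, by simpa using hx⟩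
  choose x hx using hcol
  refine ⟨(of x)ᵀ, ?_⟩
  ext i j
  exact (congrFun (hx j) i).symm

/-- A matrix whose range is contained in the kernel of `A` is annihilated by `A`. -/
theorem Matrix.mul_eq_zero_of_range_le_ker {l m k : Type*} [Fintype m] [Fintype k]
    {A : Matrix l m ℝ} {B : Matrix m k ℝ}
    (h : LinearMap.range B.mulVecLin ≤ LinearMap.ker A.mulVecLin) : A * B = 0 := by
  classical
  refine ext_of_mulVec_single fun j => ?_
  rw [← mulVec_mulVec, zero_mulVec]
  exact h ⟨Pi.single j 1, rfl⟩

/-- Two orthonormal families of columns that are mutually orthogonal and have the right total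
cardinality give a resolution of the identity. -/
theorem Matrix.mul_transpose_add_mul_transpose_eq_one {m k l : Type*} [Fintype m] [Fintype k]
    [Fintype l] [DecidableEq m] [DecidableEq k] [DecidableEq l]
    {U : Matrix m k ℝ} {V : Matrix m l ℝ}
    (hcard : Fintype.card k + Fintype.card l = Fintype.card m)
    (hU : Uᵀ * U = 1) (hV : Vᵀ * V = 1) (hUV : Uᵀ * V = 0) : U * Uᵀ + V * Vᵀ = 1 := by
  have hVU : Vᵀ * U = 0 := by simpa using congrArg transpose hUV
  have h : fromRows Uᵀ Vᵀ * fromCols U V = 1 := by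
    rw [fromRows_mul_fromCols, hU, hV, hUV, hVU, fromBlocks_one]
  rw [← fromCols_mul_fromRows]
  exact (mul_eq_one_comm_of_card_eq _ _ _ (by simpa using hcard)).1 h

/-- with `C` symmetric PSD of rank `n`, `V_C` (resp. `V_N`) an orthonormal basis
of the range (resp. null space) of `C`, and `G` satisfying `vᵀGv ≥ ε‖v‖²`, the block
`G₄ = V_Nᵀ G V_N` is invertible, `B₁₁ = V_Cᵀ G⁻¹ C V_C` is invertible, and
`B₁₁⁻¹ = C₁⁻¹ (G₁ − G₂ G₄⁻¹ G₃)`. -/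
theorem stmt_0 (N n : ℕ) (hn : 0 < n) (hnN : n < N)
    (C G : Matrix (Fin N) (Fin N) ℝ)
    (VC : Matrix (Fin N) (Fin n) ℝ) (VN : Matrix (Fin N) (Fin (N - n)) ℝ)
    (hC : C.PosSemidef) (hrank : C.rank = n)
    (hVC : VCᵀ * VC = 1)
    (hVCrange : LinearMap.range VC.mulVecLin = LinearMap.range C.mulVecLin)
    (hVN : VNᵀ * VN = 1)
    (hVNrange : LinearMap.range VN.mulVecLin = LinearMap.ker C.mulVecLin)
    (ε : ℝ) (hε : 0 < ε)
    (hG : ∀ v : Fin N → ℝ, ε * (v ⬝ᵥ v) ≤ v ⬝ᵥ G.mulVec v) :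
    IsUnit (VNᵀ * G * VN) ∧ IsUnit (VCᵀ * G⁻¹ * C * VC) ∧
      (VCᵀ * G⁻¹ * C * VC)⁻¹ =
        (VCᵀ * C * VC)⁻¹ *
          ((VCᵀ * G * VC) - (VCᵀ * G * VN) * (VNᵀ * G * VN)⁻¹ * (VNᵀ * G * VC)) := by
  obtain ⟨X, hX⟩ := exists_eq_mul_of_range_le hVCrange.le
  have hCVN : C * VN = 0 := mul_eq_zero_of_range_le_ker hVNrange.le
  have hCt : Cᵀ = C := by simpa using hC.isHermitian.eq
  have hVCVN : VCᵀ * VN = 0 := by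
    rw [hX, transpose_mul, hCt, Matrix.mul_assoc, hCVN, Matrix.mul_zero]
  have hres : VC * VCᵀ + VN * VNᵀ = 1 :=
    mul_transpose_add_mul_transpose_eq_one (by simpa using by omega) hVC hVN hVCVN
  have hCproj : C * (VC * VCᵀ) = C := by
    rw [eq_sub_of_add_eq hres, Matrix.mul_sub, ← Matrix.mul_assoc, hCVN]
    simp
  have hprojC : VC * VCᵀ * C = C := by
    simpa [hCt] using congrArg transpose hCproj
  have hGdet := (isUnit_iff_isUnit_det G).1 (isUnit_of_coercive hε hG)
  have hG4 : IsUnit (VNᵀ * G * VN) := by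
    refine isUnit_of_coercive hε fun v => ?_
    have h := hG (VN *ᵥ v)
    have hadj (w : Fin N → ℝ) : VN *ᵥ v ⬝ᵥ w = v ⬝ᵥ VNᵀ *ᵥ w := by
      rw [dotProduct_mulVec, vecMul_transpose]
    rw [hadj, hadj] at h
    simpa [mulVec_mulVec, ← Matrix.mul_assoc, hVN] using h
  have hC1 : VCᵀ * C * VC * (VCᵀ * X) = 1 := by
    calc VCᵀ * C * VC * (VCᵀ * X) = VCᵀ * (C * (VC * VCᵀ) * X) := by
          simp only [Matrix.mul_assoc]
      _ = 1 := by rw [hCproj, ← hX, hVC]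
  have hC1det : IsUnit (VCᵀ * C * VC).det := isUnit_det_of_right_inverse hC1
  have hB : VCᵀ * G⁻¹ * C * VC = VCᵀ * G⁻¹ * VC * (VCᵀ * C * VC) := by
    calc VCᵀ * G⁻¹ * C * VC = VCᵀ * G⁻¹ * (VC * VCᵀ * C) * VC := by rw [hprojC]
      _ = _ := by simp only [Matrix.mul_assoc]
  have hGVC {k : ℕ} (W : Matrix (Fin N) (Fin k) ℝ) :
      VCᵀ * G⁻¹ * VC * (VCᵀ * G * W) = VCᵀ * W - VCᵀ * G⁻¹ * VN * (VNᵀ * G * W) := by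
    calc VCᵀ * G⁻¹ * VC * (VCᵀ * G * W) = VCᵀ * G⁻¹ * (VC * VCᵀ) * (G * W) := by
          simp only [Matrix.mul_assoc]
      _ = VCᵀ * (G⁻¹ * (G * W)) - VCᵀ * G⁻¹ * VN * (VNᵀ * G * W) := by
          rw [eq_sub_of_add_eq hres]
          simp only [Matrix.mul_sub, Matrix.sub_mul, Matrix.mul_one, Matrix.mul_assoc]
      _ = _ := by rw [nonsing_inv_mul_cancel_left _ _ hGdet]
  have hschur : VCᵀ * G⁻¹ * VC *
      ((VCᵀ * G * VC) - (VCᵀ * G * VN) * (VNᵀ * G * VN)⁻¹ * (VNᵀ * G * VC)) = 1 := by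
    rw [Matrix.mul_sub, hGVC, hVC, ← Matrix.mul_assoc _ _ (VNᵀ * G * VC),
      ← Matrix.mul_assoc _ (VCᵀ * G * VN), hGVC, hVCVN, zero_sub, Matrix.neg_mul, Matrix.neg_mul,
      mul_nonsing_inv_cancel_right _ _ ((isUnit_iff_isUnit_det _).1 hG4)]
    simp
  have hinv : VCᵀ * G⁻¹ * C * VC * ((VCᵀ * C * VC)⁻¹ *
      ((VCᵀ * G * VC) - (VCᵀ * G * VN) * (VNᵀ * G * VN)⁻¹ * (VNᵀ * G * VC))) = 1 := by
    rw [hB, ← Matrix.mul_assoc, mul_nonsing_inv_cancel_right _ _ hC1det, hschur]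
  exact ⟨hG4, (isUnit_iff_isUnit_det _).2 (isUnit_det_of_right_inverse hinv),
    inv_eq_right_inv hinv⟩
end

section
/- Let N and n be positive integers with n < N, let C ∈ ℝ^{N×N} be symmetric positive semidefinite of rank n with V_C ∈ ℝ^{N×n} having orthonormal columns spanning the range of C, and let G ∈ ℝ^{N×N} satisfy v^T G v ≥ ε‖v‖² for all v ∈ ℝ^N for some ε > 0. Then every eigenvalue of B11 := V_C^T G^{-1} C V_C has strictly positive real part; that is, if λ ∈ ℂ and v ∈ ℂ^n is nonzero with B11 v = λ v, then Re(λ) > 0. -/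
open Matrix

/-- A real matrix with coercive quadratic form is invertible. -/
theorem isUnit_det_of_coercive {m : Type*} [Fintype m] [DecidableEq m]
    {G : Matrix m m ℝ} {ε : ℝ} (hε : 0 < ε)
    (hG : ∀ v : m → ℝ, ε * (v ⬝ᵥ v) ≤ v ⬝ᵥ G *ᵥ v) : IsUnit G.det := by
  rw [isUnit_iff_ne_zero]
  intro hdet
  obtain ⟨v, hv, hGv⟩ := Matrix.exists_mulVec_eq_zero_iff.mpr hdet
  have h := hG v
  rw [hGv, dotProduct_zero] at h
  have hpos : 0 < v ⬝ᵥ v := by simpa using Matrix.dotProduct_star_self_pos_iff.mpr hv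
  nlinarith

/-- The inverse of a coercive real matrix has a positive quadratic form. -/
theorem dotProduct_inv_mulVec_pos {m : Type*} [Fintype m] [DecidableEq m]
    {G : Matrix m m ℝ} {ε : ℝ} (hε : 0 < ε)
    (hG : ∀ v : m → ℝ, ε * (v ⬝ᵥ v) ≤ v ⬝ᵥ G *ᵥ v) {w : m → ℝ} (hw : w ≠ 0) :
    0 < w ⬝ᵥ G⁻¹ *ᵥ w := by
  have hGw : G *ᵥ (G⁻¹ *ᵥ w) = w := by
    rw [mulVec_mulVec, mul_nonsing_inv _ (isUnit_det_of_coercive hε hG), one_mulVec]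
  have hne : G⁻¹ *ᵥ w ≠ 0 := by
    intro h
    rw [h, mulVec_zero] at hGw
    exact hw hGw.symm
  have hpos : 0 < (G⁻¹ *ᵥ w) ⬝ᵥ (G⁻¹ *ᵥ w) := by
    simpa using Matrix.dotProduct_star_self_pos_iff.mpr hne
  have h := hG (G⁻¹ *ᵥ w)
  rw [hGw, dotProduct_comm _ w] at h
  exact (mul_pos hε hpos).trans_le h

/-- If `H` is symmetric positive semidefinite and `z ↦ ⟪H z, B z⟫` is positive definite, then
every complex eigenvalue of `B` has positive real part. -/
theorem eigenvalue_re_pos_of_dotProduct_pos {m : Type*} [Fintype m]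
    {B H : Matrix m m ℝ} (hH : H.PosSemidef)
    (hB : ∀ z : m → ℝ, z ≠ 0 → 0 < (H *ᵥ z) ⬝ᵥ (B *ᵥ z))
    {l : ℂ} {v : m → ℂ} (hv : v ≠ 0) (hl : B.map Complex.ofReal *ᵥ v = l • v) :
    0 < l.re := by
  set x : m → ℝ := fun i => (v i).re with hx
  set y : m → ℝ := fun i => (v i).im with hy
  have hBx : B *ᵥ x = l.re • x - l.im • y := by
    ext i
    simpa [mulVec, dotProduct] using congrArg Complex.re (congrFun hl i)
  have hBy : B *ᵥ y = l.re • y + l.im • x := by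
    ext i
    simpa [mulVec, dotProduct] using congrArg Complex.im (congrFun hl i)
  have hnonneg : ∀ z : m → ℝ, 0 ≤ (H *ᵥ z) ⬝ᵥ (B *ᵥ z) := by
    intro z
    rcases eq_or_ne z 0 with rfl | hz
    · simp
    · exact (hB z hz).le
  have hsum : 0 < (H *ᵥ x) ⬝ᵥ (B *ᵥ x) + (H *ᵥ y) ⬝ᵥ (B *ᵥ y) := by
    by_cases hx0 : x = 0
    · have hy0 : y ≠ 0 := by
        intro hy0
        exact hv (funext fun i => Complex.ext (congrFun hx0 i) (congrFun hy0 i))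
      exact add_pos_of_nonneg_of_pos (hnonneg x) (hB y hy0)
    · exact add_pos_of_pos_of_nonneg (hB x hx0) (hnonneg y)
  have hsymm : (H *ᵥ x) ⬝ᵥ y = (H *ᵥ y) ⬝ᵥ x := by
    have hT : Hᵀ = H := by simpa [IsSymm] using hH.isHermitian
    rw [dotProduct_comm, dotProduct_mulVec, ← mulVec_transpose, hT]
  have hHx : 0 ≤ (H *ᵥ x) ⬝ᵥ x := by
    simpa [dotProduct_comm] using hH.dotProduct_mulVec_nonneg x
  have hHy : 0 ≤ (H *ᵥ y) ⬝ᵥ y := by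
    simpa [dotProduct_comm] using hH.dotProduct_mulVec_nonneg y
  rw [hBx, hBy] at hsum
  simp only [dotProduct_sub, dotProduct_add, dotProduct_smul, smul_eq_mul, hsymm] at hsum
  by_contra! hneg
  nlinarith [mul_nonneg (neg_nonneg.mpr hneg) hHx, mul_nonneg (neg_nonneg.mpr hneg) hHy]

/-- If the columns of `V` are orthonormal and span a space containing the range of `C`, then
`V Vᵀ` fixes the range of `C`. -/
theorem mulVec_transpose_mulVec_of_range_le {m k : Type*} [Fintype m] [Fintype k] [DecidableEq k]
    {C : Matrix m m ℝ} {V : Matrix m k ℝ} (hV : Vᵀ * V = 1)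
    (hr : LinearMap.range C.mulVecLin ≤ LinearMap.range V.mulVecLin) (w : m → ℝ) :
    V *ᵥ (Vᵀ *ᵥ (C *ᵥ w)) = C *ᵥ w := by
  obtain ⟨z, hz⟩ := hr ⟨w, rfl⟩
  rw [mulVecLin_apply, mulVecLin_apply] at hz
  rw [← hz, mulVec_mulVec z, hV, one_mulVec]

/-- If `C` is symmetric and the orthonormal columns of `V` lie in the range of `C`, then `C V` is
injective. -/
theorem mulVec_mulVec_ne_zero_of_range_le {m k : Type*} [Fintype m] [Fintype k] [DecidableEq k]
    {C : Matrix m m ℝ} {V : Matrix m k ℝ} (hC : Cᵀ = C) (hV : Vᵀ * V = 1)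
    (hr : LinearMap.range V.mulVecLin ≤ LinearMap.range C.mulVecLin) {z : k → ℝ} (hz : z ≠ 0) :
    C *ᵥ (V *ᵥ z) ≠ 0 := by
  intro h
  obtain ⟨w, hw⟩ := hr ⟨z, rfl⟩
  rw [mulVecLin_apply, mulVecLin_apply] at hw
  have h0 : (V *ᵥ z) ⬝ᵥ (V *ᵥ z) = 0 := by
    nth_rewrite 2 [← hw]
    rw [dotProduct_mulVec, ← mulVec_transpose, hC, h, zero_dotProduct]
  have hVz : V *ᵥ z = 0 := dotProduct_self_eq_zero.mp h0
  apply hz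
  rw [← one_mulVec z, ← hV, ← mulVec_mulVec, hVz, mulVec_zero]

/-- under the standing assumptions, every (complex) eigenvalue of
`B₁₁ = V_Cᵀ G⁻¹ C V_C` has strictly positive real part. -/
theorem stmt_1 (N n : ℕ) (hn : 0 < n) (hnN : n < N)
    (C G : Matrix (Fin N) (Fin N) ℝ)
    (VC : Matrix (Fin N) (Fin n) ℝ)
    (hC : C.PosSemidef) (hrank : C.rank = n)
    (hVC : VCᵀ * VC = 1)
    (hVCrange : LinearMap.range VC.mulVecLin = LinearMap.range C.mulVecLin)
    (ε : ℝ) (hε : 0 < ε)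
    (hG : ∀ v : Fin N → ℝ, ε * (v ⬝ᵥ v) ≤ v ⬝ᵥ G.mulVec v) :
    ∀ (l : ℂ) (v : Fin n → ℂ), v ≠ 0 →
      ((VCᵀ * G⁻¹ * C * VC).map Complex.ofReal).mulVec v = l • v → 0 < l.re := by
  intro l v hv hl
  have hCT : Cᵀ = C := by simpa [IsSymm] using hC.isHermitian
  have hH : (VCᵀ * C * VC).PosSemidef := by
    simpa using hC.conjTranspose_mul_mul_same VC
  refine eigenvalue_re_pos_of_dotProduct_pos hH (fun z hz => ?_) hv hl
  have hw := mulVec_mulVec_ne_zero_of_range_le hCT hVC hVCrange.le hz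
  have hfix := mulVec_transpose_mulVec_of_range_le hVC hVCrange.ge (VC *ᵥ z)
  have hpos := dotProduct_inv_mulVec_pos hε hG hw
  simp only [← mulVec_mulVec]
  rw [dotProduct_mulVec, vecMul_transpose, hfix]
  exact hpos
end

section
/- Let N and n be positive integers with n < N, let C, V_C, G, B11 be as in the standing assumptions (so B11 is invertible), and let γ > 0 (so C + γG is invertible since v^T(C+γG)v ≥ γε‖v‖²). Then S11 := V_C^T (C + γG)^{-1} C V_C ∈ ℝ^{n×n} is invertible and S11^{-1} = I + γ B11^{-1}; equivalently, S11 = (I + γ B11^{-1})^{-1}. -/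
open Matrix

/-- If `V` has orthonormal columns and its range contains that of `C`, then the projection
`V * Vᵀ` fixes `C`. -/
theorem Matrix.mul_transpose_mul_eq_self_of_range_le {m k l : Type*} [Fintype m] [Fintype k]
    [DecidableEq k] [Fintype l] [DecidableEq l] {C : Matrix m l ℝ} {V : Matrix m k ℝ}
    (hV : Vᵀ * V = 1) (hVC : LinearMap.range C.mulVecLin ≤ LinearMap.range V.mulVecLin) :
    V * Vᵀ * C = C := by
  refine ext_of_mulVec_single fun i => ?_
  obtain ⟨z, hz⟩ := hVC (LinearMap.mem_range_self C.mulVecLin (Pi.single i 1))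
  simp only [mulVecLin_apply] at hz
  rw [← mulVec_mulVec, ← hz, mulVec_mulVec, Matrix.mul_assoc, hV, Matrix.mul_one]

/-- The compression of `G⁻¹ * C` to the range of a symmetric matrix `C` is invertible when `G` is
coercive. -/
theorem Matrix.isUnit_compression_inv_mul {m k : Type*} [Fintype m] [DecidableEq m] [Fintype k]
    [DecidableEq k] {C G : Matrix m m ℝ} {V : Matrix m k ℝ} (hC : C.IsSymm) (hV : Vᵀ * V = 1)
    (hVC : LinearMap.range V.mulVecLin = LinearMap.range C.mulVecLin) {ε : ℝ} (hε : 0 < ε)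
    (hG : ∀ v : m → ℝ, ε * (v ⬝ᵥ v) ≤ v ⬝ᵥ G *ᵥ v) : IsUnit (Vᵀ * G⁻¹ * C * V) := by
  have hGdet := (isUnit_iff_isUnit_det G).mp (isUnit_of_coercive hε hG)
  have hCV : C * V * Vᵀ = C := by
    simpa [hC.eq, Matrix.mul_assoc] using
      congrArg transpose (mul_transpose_mul_eq_self_of_range_le hV hVC.ge)
  rw [← mulVec_injective_iff_isUnit, ← coe_mulVecLin, injective_iff_map_eq_zero]
  intro x hx
  set y := G⁻¹ *ᵥ C *ᵥ V *ᵥ x with hy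
  have hVy : Vᵀ *ᵥ y = 0 := by
    simpa only [mulVecLin_apply, ← mulVec_mulVec] using hx
  have hGy : G *ᵥ y = C *ᵥ V *ᵥ x := by
    rw [hy, mulVec_mulVec, mul_nonsing_inv _ hGdet, one_mulVec]
  have hCy : C *ᵥ y = 0 := by
    rw [← hCV, ← mulVec_mulVec, hVy, mulVec_zero]
  have hyGy : y ⬝ᵥ G *ᵥ y = 0 := by
    rw [hGy, dotProduct_mulVec, ← mulVec_transpose, hC.eq, hCy, zero_dotProduct]
  have hy0 : y = 0 := dotProduct_self_eq_zero.mp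
    (le_antisymm (nonpos_of_mul_nonpos_right ((hG y).trans_eq hyGy) hε)
      (Finset.sum_nonneg fun i _ => mul_self_nonneg (y i)))
  have hCVx : C *ᵥ V *ᵥ x = 0 := by rw [← hGy, hy0, mulVec_zero]
  obtain ⟨z, hz⟩ := hVC.le (LinearMap.mem_range_self V.mulVecLin x)
  simp only [mulVecLin_apply] at hz
  have hVx : V *ᵥ x = 0 := by
    refine dotProduct_self_eq_zero.mp ?_
    nth_rw 2 [← hz]
    rw [dotProduct_mulVec, ← mulVec_transpose, hC.eq, hCVx, zero_dotProduct]
  rw [← one_mulVec x, ← hV, ← mulVec_mulVec, hVx, mulVec_zero]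

/-- under the standing assumptions and `γ > 0`,
`S₁₁ = V_Cᵀ (C + γG)⁻¹ C V_C` is invertible, `S₁₁⁻¹ = I + γ B₁₁⁻¹`, and
equivalently `S₁₁ = (I + γ B₁₁⁻¹)⁻¹`. -/
theorem stmt_7 (N n : ℕ) (hn : 0 < n) (hnN : n < N)
    (C G : Matrix (Fin N) (Fin N) ℝ)
    (VC : Matrix (Fin N) (Fin n) ℝ)
    (hC : C.PosSemidef) (hrank : C.rank = n)
    (hVC : VCᵀ * VC = 1)
    (hVCrange : LinearMap.range VC.mulVecLin = LinearMap.range C.mulVecLin)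
    (ε : ℝ) (hε : 0 < ε)
    (hG : ∀ v : Fin N → ℝ, ε * (v ⬝ᵥ v) ≤ v ⬝ᵥ G.mulVec v)
    (γ : ℝ) (hγ : 0 < γ)
    (B11 : Matrix (Fin n) (Fin n) ℝ) (hB11 : B11 = VCᵀ * G⁻¹ * C * VC)
    (S11 : Matrix (Fin n) (Fin n) ℝ) (hS11 : S11 = VCᵀ * (C + γ • G)⁻¹ * C * VC) :
    IsUnit S11 ∧ S11⁻¹ = 1 + γ • B11⁻¹ ∧ S11 = (1 + γ • B11⁻¹)⁻¹ := by
  have hCsymm : C.IsSymm := by simpa using hC.isHermitian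
  have hB : IsUnit B11 := hB11 ▸ isUnit_compression_inv_mul hCsymm hVC hVCrange hε hG
  have hGdet := (isUnit_iff_isUnit_det G).mp (isUnit_of_coercive hε hG)
  have hBdet := (isUnit_iff_isUnit_det B11).mp hB
  have hM : IsUnit (C + γ • G) := by
    refine isUnit_of_coercive (mul_pos hγ hε) fun v => ?_
    have hCv : 0 ≤ v ⬝ᵥ C *ᵥ v := by simpa using hC.dotProduct_mulVec_nonneg v
    rw [add_mulVec, smul_mulVec, dotProduct_add, dotProduct_smul, smul_eq_mul, mul_assoc]
    linarith [mul_le_mul_of_nonneg_left (hG v) hγ.le]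
  have hMdet := (isUnit_iff_isUnit_det _).mp hM
  have hCV : C * VC * VCᵀ = C := by
    simpa [hCsymm.eq, Matrix.mul_assoc] using
      congrArg transpose (mul_transpose_mul_eq_self_of_range_le hVC hVCrange.ge)
  have hGinv : G⁻¹ = (C + γ • G)⁻¹ * C * G⁻¹ + γ • (C + γ • G)⁻¹ := by
    calc G⁻¹ = (C + γ • G)⁻¹ * ((C + γ • G) * G⁻¹) := by
          rw [← Matrix.mul_assoc, nonsing_inv_mul _ hMdet, Matrix.one_mul]
      _ = _ := by
          rw [Matrix.add_mul, Matrix.smul_mul, mul_nonsing_inv _ hGdet, Matrix.mul_add,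
            Matrix.mul_smul, Matrix.mul_one, Matrix.mul_assoc]
  have hSB : S11 * B11 + γ • S11 = B11 := by
    calc S11 * B11 + γ • S11
        = VCᵀ * (C + γ • G)⁻¹ * (C * VC * VCᵀ) * G⁻¹ * C * VC
          + γ • (VCᵀ * (C + γ • G)⁻¹ * C * VC) := by
          rw [hS11, hB11]
          simp only [Matrix.mul_assoc]
      _ = VCᵀ * ((C + γ • G)⁻¹ * C * G⁻¹ + γ • (C + γ • G)⁻¹) * C * VC := by
          rw [hCV]
          simp only [Matrix.mul_add, Matrix.add_mul, Matrix.mul_smul, Matrix.smul_mul,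
            Matrix.mul_assoc]
      _ = B11 := by rw [← hGinv, hB11]
  have hS : S11 * (1 + γ • B11⁻¹) = 1 := by
    calc S11 * (1 + γ • B11⁻¹) = (S11 * B11 + γ • S11) * B11⁻¹ := by
          rw [Matrix.add_mul, Matrix.mul_assoc, mul_nonsing_inv _ hBdet, Matrix.mul_add,
            Matrix.mul_smul, Matrix.smul_mul]
      _ = 1 := by rw [hSB, mul_nonsing_inv _ hBdet]
  exact ⟨IsUnit.of_mul_eq_one _ hS, inv_eq_right_inv hS, (inv_eq_left_inv hS).symm⟩
end

section
/- Let C ∈ ℝ^{N×N} be symmetric positive semidefinite, let K ∈ ℝ^{N×N}, and set A := K C. Suppose x ∈ ℂ^N is nonzero, λ ∈ ℂ is nonzero, and A x = λ x. Then x* C x ≠ 0 and λ = (x* A x)/(x* x) = (x* C A x)/(x* C x); in particular every nonzero eigenvalue of A belongs both to the numerical range F(A) and to the C-numerical range F_C(A). -/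
open Matrix

theorem map_ofReal_mul {l m n : Type*} [Fintype m] (A : Matrix l m ℝ) (B : Matrix m n ℝ) :
    (A * B).map Complex.ofReal = A.map Complex.ofReal * B.map Complex.ofReal :=
  Matrix.map_mul (f := Complex.ofRealHom)

open scoped MatrixOrder ComplexOrder in
theorem Matrix.PosSemidef.map_ofReal {n : Type*} [Fintype n] {C : Matrix n n ℝ}
    (hC : C.PosSemidef) : (C.map Complex.ofReal).PosSemidef := by
  classical
  obtain ⟨B, rfl⟩ := CStarAlgebra.nonneg_iff_eq_star_mul_self.mp hC.nonneg
  have h : (star B).map Complex.ofReal = (B.map Complex.ofReal)ᴴ := by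
    ext i j
    simp [star_eq_conjTranspose]
  rw [map_ofReal_mul, h]
  exact posSemidef_conjTranspose_mul_self _

/-- for `A = K C` with `C` symmetric PSD, any nonzero eigenvalue `λ` of `A`
(with eigenvector `x ≠ 0`) satisfies `x* C x ≠ 0` and
`λ = (x* A x)/(x* x) = (x* C A x)/(x* C x)`; in particular `λ` lies both in the numerical
range `F(A)` and in the `C`-numerical range `F_C(A)`. -/
theorem stmt_8 (N : ℕ) (C K : Matrix (Fin N) (Fin N) ℝ) (hC : C.PosSemidef)
    (x : Fin N → ℂ) (hx : x ≠ 0) (l : ℂ) (hl : l ≠ 0)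
    (heig : ((K * C).map Complex.ofReal).mulVec x = l • x) :
    star x ⬝ᵥ (C.map Complex.ofReal).mulVec x ≠ 0 ∧
      l = (star x ⬝ᵥ ((K * C).map Complex.ofReal).mulVec x) / (star x ⬝ᵥ x) ∧
      l = (star x ⬝ᵥ ((C * (K * C)).map Complex.ofReal).mulVec x) /
          (star x ⬝ᵥ (C.map Complex.ofReal).mulVec x) := by
  open scoped ComplexOrder in
  have hCx : star x ⬝ᵥ (C.map Complex.ofReal).mulVec x ≠ 0 := by
    intro h
    have h0 := (hC.map_ofReal.dotProduct_mulVec_zero_iff x).mp h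
    rw [map_ofReal_mul, ← mulVec_mulVec, h0, mulVec_zero] at heig
    exact (smul_ne_zero hl hx) heig.symm
  open scoped ComplexOrder in
  have hxx : star x ⬝ᵥ x ≠ 0 := fun h => hx (dotProduct_star_self_eq_zero.mp h)
  refine ⟨hCx, ?_, ?_⟩
  · rw [heig, dotProduct_smul, smul_eq_mul, mul_div_cancel_right₀ _ hxx]
  · rw [map_ofReal_mul, ← mulVec_mulVec, heig, mulVec_smul, dotProduct_smul, smul_eq_mul,
      mul_div_cancel_right₀ _ hCx]
end

section
/- Let 0 < μ1 < μ2, let δ > 0, and let k ≥ 1 and m ≥ 1 be integers. For γ > 0 define c0(γ) := (μ2/(μ2+γ) + μ1/(μ1+γ))/2, ρ(γ) := (μ2/(μ2+γ) − μ1/(μ1+γ))/2, and the error-bound function E(γ) := (δγ)^k · (ρ(γ)/c0(γ))^m / (c0(γ) − ρ(γ)). Then E(γ) > 0 for all γ > 0, E is differentiable on (0, ∞), and the logarithmic derivative satisfies γ · E′(γ)/E(γ) ≥ k + 1 for every γ > 0 (i.e., d log E / d log γ ≥ k + 1). -/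
theorem HasDerivAt.pow_of_eq_mul {f : ℝ → ℝ} {a x : ℝ} (h : HasDerivAt f (f x * a) x) (n : ℕ) :
    HasDerivAt (fun y => f y ^ n) (f x ^ n * (n * a)) x := by
  refine (h.fun_pow n).congr_deriv ?_
  rcases n with _ | n
  · simp
  · simp only [Nat.add_sub_cancel, pow_succ]
    ring

/-- The logarithmic derivative of the error bound, with the quotients of Möbius images simplified. -/
theorem hasDerivAt_errorBound {μ1 μ2 γ : ℝ} (δ : ℝ) (h1 : 0 < μ1) (h2 : 0 < μ2) (hγ : 0 < γ)
    (k m : ℕ) :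
    HasDerivAt
      (fun x => (δ * x) ^ k * ((μ2 - μ1) * x / (2 * μ1 * μ2 + (μ1 + μ2) * x)) ^ m *
        ((μ1 + x) / μ1))
      ((δ * γ) ^ k * ((μ2 - μ1) * γ / (2 * μ1 * μ2 + (μ1 + μ2) * γ)) ^ m * ((μ1 + γ) / μ1) *
        ((k + m * (2 * μ1 * μ2 / (2 * μ1 * μ2 + (μ1 + μ2) * γ)) + γ / (μ1 + γ)) / γ)) γ := by
  have hD : 2 * μ1 * μ2 + (μ1 + μ2) * γ ≠ 0 := by positivity
  have hS : μ1 + γ ≠ 0 := by positivity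
  have hf : HasDerivAt (fun x => δ * x) (δ * γ * (1 / γ)) γ := by
    refine ((hasDerivAt_id' γ).const_mul δ).congr_deriv ?_
    field_simp
  have hg : HasDerivAt (fun x => (μ2 - μ1) * x / (2 * μ1 * μ2 + (μ1 + μ2) * x))
      ((μ2 - μ1) * γ / (2 * μ1 * μ2 + (μ1 + μ2) * γ) *
        (2 * μ1 * μ2 / (2 * μ1 * μ2 + (μ1 + μ2) * γ) / γ)) γ := by
    refine (((hasDerivAt_id' γ).const_mul (μ2 - μ1)).fun_div
      (((hasDerivAt_id' γ).const_mul (μ1 + μ2)).const_add (2 * μ1 * μ2)) hD).congr_deriv ?_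
    field_simp
    ring
  have hl : HasDerivAt (fun x => (μ1 + x) / μ1) (1 / μ1) γ :=
    ((hasDerivAt_id' γ).const_add μ1).div_const μ1
  refine (((hf.pow_of_eq_mul k).fun_mul (hg.pow_of_eq_mul m)).fun_mul hl).congr_deriv ?_
  generalize ((μ2 - μ1) * γ / (2 * μ1 * μ2 + (μ1 + μ2) * γ)) ^ m = B
  generalize (δ * γ) ^ k = A
  field_simp

/-- for the error-bound function
`E(γ) = (δγ)^k (ρ(γ)/c₀(γ))^m / (c₀(γ) − ρ(γ))` (with `c₀, ρ` the Möbius images of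
`[μ₁, μ₂]` under `μ ↦ μ/(μ+γ)`), one has `E(γ) > 0` on `(0,∞)`, `E` is differentiable on
`(0,∞)`, and the logarithmic derivative satisfies `γ E′(γ)/E(γ) ≥ k + 1` for all `γ > 0`. -/
theorem stmt_19 (μ1 μ2 δ : ℝ) (hμ1 : 0 < μ1) (hμ12 : μ1 < μ2) (hδ : 0 < δ)
    (k m : ℕ) (hk : 1 ≤ k) (hm : 1 ≤ m)
    (c0 ρ : ℝ → ℝ)
    (hc0 : c0 = fun γ => (μ2 / (μ2 + γ) + μ1 / (μ1 + γ)) / 2)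
    (hρ : ρ = fun γ => (μ2 / (μ2 + γ) - μ1 / (μ1 + γ)) / 2)
    (E : ℝ → ℝ)
    (hE : E = fun γ => (δ * γ) ^ k * (ρ γ / c0 γ) ^ m / (c0 γ - ρ γ)) :
    (∀ γ : ℝ, 0 < γ → 0 < E γ) ∧
      (∀ γ : ℝ, 0 < γ → DifferentiableAt ℝ E γ) ∧
      ∀ γ : ℝ, 0 < γ → (k : ℝ) + 1 ≤ γ * deriv E γ / E γ := by
  have hμ2 : 0 < μ2 := hμ1.trans hμ12
  have hE' : ∀ x, 0 < x → E x = (δ * x) ^ k *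
      ((μ2 - μ1) * x / (2 * μ1 * μ2 + (μ1 + μ2) * x)) ^ m * ((μ1 + x) / μ1) := by
    intro x hx
    have hq : ρ x / c0 x = (μ2 - μ1) * x / (2 * μ1 * μ2 + (μ1 + μ2) * x) := by
      have hc : (μ2 / (μ2 + x) + μ1 / (μ1 + x)) / 2 ≠ 0 := by positivity
      have hD : 2 * μ1 * μ2 + (μ1 + μ2) * x ≠ 0 := by positivity
      simp only [hρ, hc0]
      rw [div_eq_div_iff hc hD]
      field_simp
      ring
    have hs : c0 x - ρ x = μ1 / (μ1 + x) := by
      simp only [hρ, hc0]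
      ring
    simp only [hE]
    rw [hq, hs, div_eq_mul_inv _ (μ1 / (μ1 + x)), inv_div]
  have hpos : ∀ x, 0 < x → 0 < E x := by
    intro x hx
    have hd : 0 < μ2 - μ1 := sub_pos.2 hμ12
    rw [hE' x hx]
    positivity
  have hder : ∀ x, 0 < x → HasDerivAt E (E x *
      ((k + m * (2 * μ1 * μ2 / (2 * μ1 * μ2 + (μ1 + μ2) * x)) + x / (μ1 + x)) / x)) x := by
    intro x hx
    rw [hE' x hx]
    exact (hasDerivAt_errorBound δ hμ1 hμ2 hx k m).congr_of_eventuallyEq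
      ((eventually_gt_nhds hx).mono hE')
  refine ⟨hpos, fun x hx => (hder x hx).differentiableAt, fun x hx => ?_⟩
  have hEx : E x ≠ 0 := (hpos x hx).ne'
  have hlog : x * deriv E x / E x =
      k + m * (2 * μ1 * μ2 / (2 * μ1 * μ2 + (μ1 + μ2) * x)) + x / (μ1 + x) := by
    rw [(hder x hx).deriv]
    field_simp
  have hm' : (1 : ℝ) ≤ m := by exact_mod_cast hm
  have hq : μ1 / (μ1 + x) ≤ 2 * μ1 * μ2 / (2 * μ1 * μ2 + (μ1 + μ2) * x) := by
    rw [div_le_div_iff₀ (by positivity) (by positivity)]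
    nlinarith [mul_pos (mul_pos hμ1 hx) (sub_pos.2 hμ12)]
  have hone : μ1 / (μ1 + x) + x / (μ1 + x) = 1 := by field_simp
  have hle := le_mul_of_one_le_left
    (by positivity : 0 ≤ 2 * μ1 * μ2 / (2 * μ1 * μ2 + (μ1 + μ2) * x)) hm'
  rw [hlog]
  linarith
end
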